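/- arXiv:2511.10422 — 2 statements merged into one kernel-verified Lean document; each statement's English description precedes it below -/
import Mathlib

section
/- Let q : ℝ with q ≠ 0 and let r, s, t be nonzero integers. If the matrix M := (B q)^r * A^{-s} * (B q)^t in SL(2,ℝ) satisfies M 1 0 = 0, then q = ((r : ℝ) + t)/(r*s*t). (Every nonzero 1-step relation number has the form (r+t)/(rst).) -/
abbrev SL2R := Matrix.SpecialLinearGroup (Fin 2) ℝ

/-- The matrix `A = [[1,1],[0,1]]` in `SL(2,ℝ)`. -/
def A : SL2R := ⟨!![1,1;0,1], by norm_num [Matrix.det_fin_two_of]⟩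

/-- The matrix `B q = [[1,0],[q,1]]` in `SL(2,ℝ)`. -/
def B (q : ℝ) : SL2R := ⟨!![1,0;q,1], by norm_num [Matrix.det_fin_two_of]⟩

theorem B_mul_B (p q : ℝ) : B p * B q = B (p + q) := by
  ext i j
  rw [Matrix.SpecialLinearGroup.coe_mul]
  fin_cases i <;> fin_cases j <;> simp [B]

theorem B_zpow (q : ℝ) (n : ℤ) : B q ^ n = B (n * q) := by
  have hzero : B 0 = 1 := by
    ext i j
    fin_cases i <;> fin_cases j <;> simp [B]
  have hinv : (B q)⁻¹ = B (-q) := by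
    rw [inv_eq_iff_mul_eq_one, B_mul_B, add_neg_cancel, hzero]
  induction n with
  | zero => simp [hzero]
  | succ n ih => rw [zpow_add_one, ih, B_mul_B]; congr 1; push_cast; ring
  | pred n ih => rw [zpow_sub_one, ih, hinv, B_mul_B]; congr 1; push_cast; ring

theorem coe_A_zpow (n : ℤ) : ((A ^ n : SL2R) : Matrix (Fin 2) (Fin 2) ℝ) = !![1, (n : ℝ); 0, 1] := by
  have hinv : ((A⁻¹ : SL2R) : Matrix (Fin 2) (Fin 2) ℝ) = !![1, -1; 0, 1] := by
    rw [Matrix.SpecialLinearGroup.coe_inv]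
    simp [A, Matrix.adjugate_fin_two]
  induction n with
  | zero => simp [Matrix.one_fin_two]
  | succ n ih =>
    rw [zpow_add_one, Matrix.SpecialLinearGroup.coe_mul, ih]
    simp [A, add_comm]
  | pred n ih =>
    rw [zpow_sub_one, Matrix.SpecialLinearGroup.coe_mul, ih, hinv]
    simp [sub_eq_add_neg, add_comm]

/-- Every nonzero 1-step relation number has the form `(r+t)/(rst)`. -/
theorem one_step_relation_form (q : ℝ) (hq : q ≠ 0) (r s t : ℤ)
    (hr : r ≠ 0) (hs : s ≠ 0) (ht : t ≠ 0)
    (h : ((B q) ^ r * A ^ (-s) * (B q) ^ t) 1 0 = 0) :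
    q = ((r : ℝ) + t) / (r * s * t) := by
  have hr' : (r : ℝ) ≠ 0 := Int.cast_ne_zero.mpr hr
  have hs' : (s : ℝ) ≠ 0 := Int.cast_ne_zero.mpr hs
  have ht' : (t : ℝ) ≠ 0 := Int.cast_ne_zero.mpr ht
  rw [B_zpow, B_zpow, Matrix.SpecialLinearGroup.coe_mul, Matrix.SpecialLinearGroup.coe_mul,
    coe_A_zpow] at h
  simp [B] at h
  rw [eq_div_iff (by positivity)]
  apply mul_left_cancel₀ hq
  linear_combination -h
end

section
/- Let P : ℕ → ℤ be the Pell sequence, i.e. P 0 = 0, P 1 = 1, and P (n+2) = 2 * P (n+1) + P n for all n. Let n ≥ 1, set q := ((P (n+1) : ℝ)) / (P n) and x := (-1)^(n+1) * 2 * P n * P (n-1) : ℤ. Then the matrix M := A * (B q)^x * A * (B q)⁻¹ * A * (B q)⁻¹ in SL(2,ℝ) satisfies M 0 0 = M 1 1; i.e. (1, x, 1, -1, 1, -1) is a length-6 half-relation for the Pell ratio P_{n+1}/P_n. -/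
theorem coe_B_zpow (q : ℝ) (k : ℤ) :
    ((B q ^ k : SL2R) : Matrix (Fin 2) (Fin 2) ℝ) = !![1, 0; q * k, 1] := by
  have hmul (r s : ℝ) : B r * B s = B (r + s) := by
    apply Subtype.ext
    rw [Matrix.SpecialLinearGroup.coe_mul]
    simp [B]
  have hone : B 0 = 1 := by
    apply Subtype.ext
    rw [Matrix.SpecialLinearGroup.coe_one]
    simp [B, Matrix.one_fin_two]
  have hinv (r : ℝ) : (B r)⁻¹ = B (-r) :=
    inv_eq_of_mul_eq_one_right (by rw [hmul, add_neg_cancel, hone])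
  have hpow : B q ^ k = B (q * k) := by
    induction k with
    | zero => simp [hone]
    | succ k ih =>
      rw [zpow_add_one, ih, hmul]
      congr 1
      push_cast
      ring
    | pred k ih =>
      rw [zpow_sub_one, ih, hinv, hmul]
      congr 1
      push_cast
      ring
  rw [hpow]
  rfl

/-- A sufficient condition on `k` for `A B^k A B⁻¹ A B⁻¹` to have equal diagonal entries. -/
theorem diag_eq_of_quadratic (q : ℝ) (k : ℤ)
    (h : (k : ℝ) * (q ^ 2 - 2 * q - 1) + 2 * (q - 2) = 0) :
    (A * B q ^ k * A * (B q)⁻¹ * A * (B q)⁻¹) 0 0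
      = (A * B q ^ k * A * (B q)⁻¹ * A * (B q)⁻¹) 1 1 := by
  rw [← zpow_neg_one (B q)]
  simp only [Matrix.SpecialLinearGroup.coe_mul, coe_B_zpow]
  simp [A, Matrix.mul_apply, Fin.sum_univ_two]
  linear_combination q * h

/-- The Cassini-type identity for Pell numbers. -/
theorem pell_sq_sub (P : ℕ → ℤ) (hP0 : P 0 = 0) (hP1 : P 1 = 1)
    (hPrec : ∀ n, P (n + 2) = 2 * P (n + 1) + P n) (n : ℕ) :
    P (n + 1) ^ 2 - 2 * P (n + 1) * P n - P n ^ 2 = (-1) ^ n := by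
  induction n with
  | zero => simp [hP0, hP1]
  | succ n ih =>
    rw [hPrec, pow_succ]
    linear_combination -ih

theorem pell_nonneg_and_succ_pos (P : ℕ → ℤ) (hP0 : P 0 = 0) (hP1 : P 1 = 1)
    (hPrec : ∀ n, P (n + 2) = 2 * P (n + 1) + P n) (n : ℕ) :
    0 ≤ P n ∧ 0 < P (n + 1) := by
  induction n with
  | zero => simp [hP0, hP1]
  | succ n ih =>
    have := hPrec n
    constructor <;> linarith [ih.1, ih.2]

/-- `(1, x, 1, -1, 1, -1)` with `x = (-1)^{n+1}·2·Pₙ·Pₙ₋₁` is a length-6 half-relation for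
the Pell ratio `Pₙ₊₁/Pₙ`. -/
theorem pell_half_relation (P : ℕ → ℤ)
    (hP0 : P 0 = 0) (hP1 : P 1 = 1)
    (hPrec : ∀ n, P (n + 2) = 2 * P (n + 1) + P n)
    (n : ℕ) (hn : 1 ≤ n) :
    (A * (B ((P (n + 1) : ℝ) / (P n : ℝ))) ^ ((-1 : ℤ) ^ (n + 1) * 2 * P n * P (n - 1))
        * A * (B ((P (n + 1) : ℝ) / (P n : ℝ)))⁻¹
        * A * (B ((P (n + 1) : ℝ) / (P n : ℝ)))⁻¹) 0 0
      = (A * (B ((P (n + 1) : ℝ) / (P n : ℝ))) ^ ((-1 : ℤ) ^ (n + 1) * 2 * P n * P (n - 1))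
        * A * (B ((P (n + 1) : ℝ) / (P n : ℝ)))⁻¹
        * A * (B ((P (n + 1) : ℝ) / (P n : ℝ)))⁻¹) 1 1 := by
  obtain ⟨m, rfl⟩ : ∃ m, n = m + 1 := ⟨n - 1, by omega⟩
  apply diag_eq_of_quadratic
  have hb : (P (m + 1) : ℝ) ≠ 0 := by
    exact_mod_cast (pell_nonneg_and_succ_pos P hP0 hP1 hPrec m).2.ne'
  have hsq : (P (m + 1 + 1) : ℝ) ^ 2 - 2 * P (m + 1 + 1) * P (m + 1) - (P (m + 1) : ℝ) ^ 2
      = (-1) ^ (m + 1) := by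
    exact_mod_cast pell_sq_sub P hP0 hP1 hPrec (m + 1)
  have hrec : (P (m + 1 + 1) : ℝ) = 2 * P (m + 1) + P m := by
    exact_mod_cast hPrec m
  have hsign : ((-1 : ℝ) ^ (m + 1)) ^ 2 = 1 := by
    rw [← pow_mul, mul_comm, pow_mul]
    simp
  have hquad : ((P (m + 1 + 1) : ℝ) / P (m + 1)) ^ 2 - 2 * (P (m + 1 + 1) / P (m + 1)) - 1
      = (-1) ^ (m + 1) / (P (m + 1) : ℝ) ^ 2 := by
    rw [← hsq]
    field_simp
  have hlin : (P (m + 1 + 1) : ℝ) / P (m + 1) - 2 = P m / P (m + 1) := by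
    rw [hrec]
    field_simp
    ring
  rw [hquad, hlin, Nat.add_sub_cancel]
  push_cast
  rw [pow_succ _ (m + 1)]
  field_simp
  linear_combination -2 * (P m : ℝ) * hsign
end
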